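/- Let (V,+,⋉,⋊) be a double near algebra with identities e_⋉, e_⋊. Let h ∈ V be such that h_u := u(1−u)·h + (1−u)·e_⋊ + u·e_⋉ is ⋉-invertible for every u > 0 and w_{ru} := h_u^{−⋉} ⋉ h_r is ⋊-invertible for all 0 ≤ r < u, and define x_{sru} := w_{ru}^{−⋊} ⋊ w_{su} for 0 ≤ r < s < u. Then the family (x_{sru})_{0≤r<s<u} is a two-way flow in V if and only if h is a flow generator. -/

import Mathlib

/-- A double near algebra (DNA): a real vector space with two multiplications `lm` (⋉)
and `rm` (⋊), each associative, left-distributive and left-homogeneous with identities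
`el = e_⋉` and `er = e_⋊`, such that `x ⋊ e_⋉ = e_⋉` and `x ⋉ e_⋊ = e_⋊` for all `x`. -/
structure DNA (W : Type*) [AddCommGroup W] [Module ℝ W] where
  lm : W → W → W
  rm : W → W → W
  el : W
  er : W
  lm_assoc : ∀ x y z, lm (lm x y) z = lm x (lm y z)
  rm_assoc : ∀ x y z, rm (rm x y) z = rm x (rm y z)
  lm_add : ∀ x y z, lm x (y + z) = lm x y + lm x z
  rm_add : ∀ x y z, rm x (y + z) = rm x y + rm x z
  lm_smul : ∀ (c : ℝ) (x y : W), lm x (c • y) = c • lm x y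
  rm_smul : ∀ (c : ℝ) (x y : W), rm x (c • y) = c • rm x y
  lm_el : ∀ x, lm x el = x
  el_lm : ∀ x, lm el x = x
  rm_er : ∀ x, rm x er = x
  er_rm : ∀ x, rm er x = x
  rm_el : ∀ x, rm x el = el
  lm_er : ∀ x, lm x er = er

variable {W : Type*} [AddCommGroup W] [Module ℝ W]

/-- `y` is a two-sided ⋉-inverse of `x`. -/
def DNA.LInv (D : DNA W) (x y : W) : Prop := D.lm x y = D.el ∧ D.lm y x = D.el

/-- `y` is a two-sided ⋊-inverse of `x`. -/
def DNA.RInv (D : DNA W) (x y : W) : Prop := D.rm x y = D.er ∧ D.rm y x = D.er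

/-- A two-way flow: a family `x s r u` (for `0 ≤ r < s < u`) of ⋉- and ⋊-invertible
elements satisfying the flow equations `x s r u ⋊ x t s u = x t r u` and
`x t r u ⋉ x s r t = x s r u` for `0 ≤ r < s < t < u`, together with the structure
condition: `(x s r u − e_⋉)/(u−s) + (x s r u − e_⋊)/(s−r)` does not depend on `s ∈ (r,u)`. -/
def DNA.IsTwoWayFlow (D : DNA W) (x : ℝ → ℝ → ℝ → W) : Prop :=
  (∀ r s u : ℝ, 0 ≤ r → r < s → s < u →
    (∃ y, D.LInv (x s r u) y) ∧ (∃ y, D.RInv (x s r u) y)) ∧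
  (∀ r s t u : ℝ, 0 ≤ r → r < s → s < t → t < u →
    D.rm (x s r u) (x t s u) = x t r u ∧ D.lm (x t r u) (x s r t) = x s r u) ∧
  (∀ r s s' u : ℝ, 0 ≤ r → r < s → s < u → r < s' → s' < u →
    (u - s)⁻¹ • (x s r u - D.el) + (s - r)⁻¹ • (x s r u - D.er) =
    (u - s')⁻¹ • (x s' r u - D.el) + (s' - r)⁻¹ • (x s' r u - D.er))

/-- `h_r = r(1−r)•h + (1−r)•e_⋊ + r•e_⋉`. -/
def DNA.hcurve (D : DNA W) (h : W) (r : ℝ) : W :=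
  (r * (1 - r)) • h + (1 - r) • D.er + r • D.el

/-- `h` is a flow generator: `h_u` is ⋉-invertible for every `u > 0`, the elements
`w r u = h_u^{−⋉} ⋉ h_r` are ⋊-invertible and ⋉-invertible for `0 < r < u`, and for all
`0 < r < s < u` the element `w r s^{−⋊} ⋊ w s u^{−⋉}` is ⋉-invertible with
`w r u^{−⋊} ⋊ w s u = (w r s^{−⋊} ⋊ w s u^{−⋉})^{−⋉}`. -/
def DNA.IsFlowGenerator (D : DNA W) (h : W) : Prop :=
  (∀ u : ℝ, 0 < u → ∃ y, D.LInv (D.hcurve h u) y) ∧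
  (∀ r u : ℝ, 0 < r → r < u → ∀ hui, D.LInv (D.hcurve h u) hui →
    ∃ y, D.RInv (D.lm hui (D.hcurve h r)) y) ∧
  (∀ s u : ℝ, 0 < s → s < u → ∀ hui, D.LInv (D.hcurve h u) hui →
    ∃ y, D.LInv (D.lm hui (D.hcurve h s)) y) ∧
  (∀ r s u : ℝ, 0 < r → r < s → s < u →
    ∀ hsi hui wrui wrsi wsui,
      D.LInv (D.hcurve h s) hsi →
      D.LInv (D.hcurve h u) hui →
      D.RInv (D.lm hui (D.hcurve h r)) wrui →
      D.RInv (D.lm hsi (D.hcurve h r)) wrsi →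
      D.LInv (D.lm hui (D.hcurve h s)) wsui →
      ∃ z, D.LInv (D.rm wrsi wsui) z ∧
        D.rm wrui (D.lm hui (D.hcurve h s)) = z)

theorem DNA.LInv.uniq {D : DNA W} {x y z : W} (hy : D.LInv x y) (hz : D.LInv x z) : y = z := by
  have : D.lm (D.lm y x) z = D.lm y (D.lm x z) := D.lm_assoc _ _ _
  rw [hy.2, hz.1, D.el_lm, D.lm_el] at this
  exact this.symm

theorem DNA.RInv.uniq {D : DNA W} {x y z : W} (hy : D.RInv x y) (hz : D.RInv x z) : y = z := by
  have : D.rm (D.rm y x) z = D.rm y (D.rm x z) := D.rm_assoc _ _ _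
  rw [hy.2, hz.1, D.er_rm, D.rm_er] at this
  exact this.symm

def DNA.L (D : DNA W) (x : W) : W →ₗ[ℝ] W where
  toFun := D.lm x
  map_add' := D.lm_add x
  map_smul' := fun c y => D.lm_smul c x y

def DNA.R (D : DNA W) (x : W) : W →ₗ[ℝ] W where
  toFun := D.rm x
  map_add' := D.rm_add x
  map_smul' := fun c y => D.rm_smul c x y

theorem DNA.hcurve_lagrange (D : DNA W) (h : W) (r t u s : ℝ) (h1 : t - r ≠ 0) (h2 : u - r ≠ 0)
    (h3 : u - t ≠ 0) :
    D.hcurve h s = ((t - s) * (u - s) / ((t - r) * (u - r))) • D.hcurve h r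
      + ((s - r) * (u - s) / ((t - r) * (u - t))) • D.hcurve h t
      + ((s - r) * (s - t) / ((u - r) * (u - t))) • D.hcurve h u := by
  unfold DNA.hcurve
  match_scalars <;> field_simp <;> ring

theorem DNA.ext3 (D : DNA W) (h : W) (F G : W →ₗ[ℝ] W) (r t u s : ℝ) (h1 : r < t) (h2 : t < u)
    (er : F (D.hcurve h r) = G (D.hcurve h r)) (et : F (D.hcurve h t) = G (D.hcurve h t))
    (eu : F (D.hcurve h u) = G (D.hcurve h u)) : F (D.hcurve h s) = G (D.hcurve h s) := by
  rw [D.hcurve_lagrange h r t u s (by linarith) (by linarith) (by linarith)]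
  simp only [map_add, map_smul, er, et, eu]

theorem DNA.hcurve_two (D : DNA W) (h : W) (r u s : ℝ) (h2 : u - r ≠ 0) :
    D.hcurve h s = ((s - r) / (u - r)) • D.hcurve h u + ((u - s) / (u - r)) • D.hcurve h r
      + ((s - r) * (u - s)) • h := by
  unfold DNA.hcurve
  match_scalars <;> field_simp <;> ring

theorem DNA.struct_aux (D : DNA W) (h : W) (F : W →ₗ[ℝ] W) (r u s : ℝ) (h1 : r < s) (h2 : s < u)
    (er : F (D.hcurve h r) = D.er) (eu : F (D.hcurve h u) = D.el) :
    (u - s)⁻¹ • (F (D.hcurve h s) - D.el) + (s - r)⁻¹ • (F (D.hcurve h s) - D.er)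
      = (u - r) • F h := by
  have a : u - r ≠ 0 := by linarith
  have b : u - s ≠ 0 := by linarith
  have c : s - r ≠ 0 := by linarith
  rw [D.hcurve_two h r u s a]
  simp only [map_add, map_smul, er, eu]
  match_scalars <;> field_simp <;> ring

/-- Let `h_u` be ⋉-invertible for `u > 0` (with inverse `hinv u`) and let
`w r u = h_u^{−⋉} ⋉ h_r` be ⋊-invertible for `0 ≤ r < u` (with inverse `winv r u`).
The family `x s r u = w r u^{−⋊} ⋊ w s u` is a two-way flow iff `h` is a flow
generator. -/
theorem stmt10 (D : DNA W) (h : W)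
    (hinv : ℝ → W) (hhinv : ∀ u : ℝ, 0 < u → D.LInv (D.hcurve h u) (hinv u))
    (winv : ℝ → ℝ → W)
    (hwinv : ∀ r u : ℝ, 0 ≤ r → r < u → D.RInv (D.lm (hinv u) (D.hcurve h r)) (winv r u))
    (x : ℝ → ℝ → ℝ → W)
    (hx : ∀ r s u : ℝ, 0 ≤ r → r < s → s < u →
      x s r u = D.rm (winv r u) (D.lm (hinv u) (D.hcurve h s))) :
    D.IsTwoWayFlow x ↔ D.IsFlowGenerator h := by
  have h0 : D.hcurve h 0 = D.er := by simp [DNA.hcurve]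
  have wl : ∀ s u : ℝ, 0 < s → 0 < u →
      D.LInv (D.lm (hinv u) (D.hcurve h s)) (D.lm (hinv s) (D.hcurve h u)) := by
    intro s u hs hu
    constructor
    · rw [D.lm_assoc, ← D.lm_assoc (D.hcurve h s), (hhinv s hs).1, D.el_lm, (hhinv u hu).2]
    · rw [D.lm_assoc, ← D.lm_assoc (D.hcurve h u), (hhinv u hu).1, D.el_lm, (hhinv s hs).2]
  -- the linear maps
  let F : ℝ → ℝ → W →ₗ[ℝ] W := fun r u => (D.R (winv r u)).comp (D.L (hinv u))
  have Fdef : ∀ r u y, F r u y = D.rm (winv r u) (D.lm (hinv u) y) := fun _ _ _ => rfl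
  have Fr : ∀ r u, 0 ≤ r → r < u → F r u (D.hcurve h r) = D.er := by
    intro r u hr hu
    rw [Fdef, (hwinv r u hr hu).2]
  have Fu : ∀ r u, 0 ≤ r → r < u → F r u (D.hcurve h u) = D.el := by
    intro r u hr hu
    rw [Fdef, (hhinv u (by linarith)).2, D.rm_el]
  have hxF : ∀ r s u : ℝ, 0 ≤ r → r < s → s < u → x s r u = F r u (D.hcurve h s) := hx
  have winv0 : ∀ u, 0 < u → winv 0 u = D.er := by
    intro u hu
    have := hwinv 0 u le_rfl hu
    rw [h0, D.lm_er] at this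
    exact this.uniq ⟨D.rm_er _, D.rm_er _⟩
  have x0 : ∀ s u, 0 < s → s < u → x s 0 u = D.lm (hinv u) (D.hcurve h s) := by
    intro s u hs hu
    rw [hx 0 s u le_rfl hs hu, winv0 u (by linarith), D.er_rm]
  constructor
  · rintro ⟨f1, f2, -⟩
    refine ⟨fun u hu => ⟨_, hhinv u hu⟩, ?_, ?_, ?_⟩
    · intro r u hr hu hui hi
      rw [hi.uniq (hhinv u (by linarith))]
      exact ⟨_, hwinv r u hr.le hu⟩
    · intro s u hs hu hui hi
      rw [hi.uniq (hhinv u (by linarith))]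
      exact ⟨_, wl s u hs (by linarith)⟩
    · intro r t u hr hrt htu hti hui wrui wrti wtui i1 i2 i3 i4 i5
      obtain rfl := i1.uniq (hhinv t (by linarith))
      obtain rfl := i2.uniq (hhinv u (by linarith))
      obtain rfl := i3.uniq (hwinv r u hr.le (by linarith))
      obtain rfl := i4.uniq (hwinv r t hr.le (by linarith))
      obtain rfl := i5.uniq (wl t u (by linarith) (by linarith))
      refine ⟨_, ?_, rfl⟩
      rw [← hx r t u hr.le hrt htu]
      obtain ⟨y, hy⟩ := (f1 r t u hr.le hrt htu).1
      have key := D.ext3 h ((D.L (x t r u)).comp (F r t)) (F r u) r ((r + t) / 2) t u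
        (by linarith) (by linarith)
        (by
          rw [LinearMap.comp_apply, Fr r t hr.le hrt, Fr r u hr.le (by linarith)]
          exact D.lm_er _)
        (by
          rw [LinearMap.comp_apply, ← hxF _ _ _ hr.le (by linarith) (by linarith),
            ← hxF _ _ _ hr.le (by linarith) (by linarith)]
          exact (f2 r ((r + t) / 2) t u hr.le (by linarith) (by linarith) htu).2)
        (by
          rw [LinearMap.comp_apply, Fu r t hr.le hrt, ← hxF r t u hr.le hrt htu]
          exact D.lm_el _)
      rw [Fu r u hr.le (by linarith)] at key
      have key' : D.lm (x t r u) (D.rm (winv r t) (D.lm (hinv t) (D.hcurve h u))) = D.el := key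
      have e : y = D.rm (winv r t) (D.lm (hinv t) (D.hcurve h u)) := by
        have := D.lm_assoc y (x t r u) (D.rm (winv r t) (D.lm (hinv t) (D.hcurve h u)))
        rw [hy.2, key', D.el_lm, D.lm_el] at this
        exact this.symm
      rw [← e]
      exact ⟨hy.2, hy.1⟩
  · rintro ⟨-, -, -, g⟩
    have g' : ∀ r t u : ℝ, 0 < r → r < t → t < u →
        D.LInv (x t r u) (F r t (D.hcurve h u)) := by
      intro r t u hr hrt htu
      obtain ⟨z, hz, e⟩ := g r t u hr hrt htu _ _ _ _ _ (hhinv t (by linarith))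
        (hhinv u (by linarith)) (hwinv r u hr.le (by linarith)) (hwinv r t hr.le hrt)
        (wl t u (by linarith) (by linarith))
      rw [hx r t u hr.le hrt htu, e]
      exact ⟨hz.2, hz.1⟩
    refine ⟨?_, ?_, ?_⟩
    · intro r s u hr hrs hsu
      constructor
      · rcases hr.eq_or_lt with rfl | hr
        · rw [x0 s u hrs hsu]
          exact ⟨_, wl s u hrs (by linarith)⟩
        · exact ⟨_, g' r s u hr hrs hsu⟩
      · have a := hwinv r u hr (by linarith)
        have b := hwinv s u (by linarith) hsu
        refine ⟨D.rm (winv s u) (D.lm (hinv u) (D.hcurve h r)), ?_, ?_⟩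
        · rw [hx r s u hr hrs hsu, D.rm_assoc,
            ← D.rm_assoc (D.lm (hinv u) (D.hcurve h s)), b.1, D.er_rm, a.2]
        · rw [hx r s u hr hrs hsu, D.rm_assoc,
            ← D.rm_assoc (D.lm (hinv u) (D.hcurve h r)), a.1, D.er_rm, b.2]
    · intro r s t u hr hrs hst htu
      constructor
      · have b := hwinv s u (by linarith) (by linarith)
        rw [hx r s u hr hrs (by linarith), hx s t u (by linarith) hst htu,
          hx r t u hr (by linarith) htu, D.rm_assoc,
          ← D.rm_assoc (D.lm (hinv u) (D.hcurve h s)), b.1, D.er_rm]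
      · rcases hr.eq_or_lt with rfl | hr
        · rw [x0 t u (by linarith) htu, x0 s t hrs hst, x0 s u hrs (by linarith), D.lm_assoc,
            ← D.lm_assoc (D.hcurve h t), (hhinv t (by linarith)).1, D.el_lm]
        · have hrt : r < t := by linarith
          have key := D.ext3 h ((D.L (x t r u)).comp (F r t)) (F r u) r t u s hrt htu
            (by
              rw [LinearMap.comp_apply, Fr r t hr.le hrt, Fr r u hr.le (by linarith)]
              exact D.lm_er _)
            (by
              rw [LinearMap.comp_apply, Fu r t hr.le hrt, ← hxF r t u hr.le hrt htu]
              exact D.lm_el _)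
            (by
              rw [LinearMap.comp_apply, Fu r u hr.le (by linarith)]
              exact (g' r t u hr hrt htu).1)
          rw [LinearMap.comp_apply, ← hxF r s t hr.le hrs hst,
            ← hxF r s u hr.le hrs (by linarith)] at key
          exact key
    · intro r s s' u hr hrs hsu hrs' hsu'
      rw [hxF r s u hr hrs hsu, hxF r s' u hr hrs' hsu',
        D.struct_aux h _ r u s hrs hsu (Fr r u hr (by linarith)) (Fu r u hr (by linarith)),
        D.struct_aux h _ r u s' hrs' hsu' (Fr r u hr (by linarith)) (Fu r u hr (by linarith))]
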